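/- For each M > 0, each ω ∈ S_M, and any constants W > 0 and γ ≥ 0 with ω = 1_{{x ∈ ℝ²₊ : 𝒢[ω](x) − W·x₂ − γ > 0}} a.e. in ℝ²₊: if the mass is not saturated, i.e. ‖ω‖₁ < 1, then the flux constant vanishes, γ = 0. -/

import Mathlib

open MeasureTheory Real Set NNReal Filter Topology

noncomputable section

/-- The upper half plane `ℝ²₊`. -/
def H : Set (ℝ × ℝ) := {p | 0 < p.2}

/-- The half-plane Green function
`G(x,y) = (1/(4π)) log(1 + 4 x₂ y₂ / |x-y|²)` (Euclidean distance). -/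
def G (x y : ℝ × ℝ) : ℝ :=
  (1 / (4 * π)) * Real.log (1 + 4 * x.2 * y.2 / ((x.1 - y.1) ^ 2 + (x.2 - y.2) ^ 2))

/-- The potential `𝒢[ω](x) = ∫_{ℝ²₊} G(x,y) ω(y) dy`. -/
def Gpot (ω : ℝ × ℝ → ℝ) (x : ℝ × ℝ) : ℝ := ∫ y in H, G x y * ω y

/-- The kinetic energy `E(ω) = (1/2) ∫∫ G(x,y) ω(x) ω(y) dy dx`. -/
def energy (ω : ℝ × ℝ → ℝ) : ℝ :=
  (1 / 2) * ∫ x in H, ∫ y in H, G x y * ω x * ω y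

/-- The `L¹(ℝ²₊)` norm (mass). -/
def norm1 (ω : ℝ × ℝ → ℝ) : ℝ := ∫ x in H, |ω x|

/-- The `L²(ℝ²₊)` norm. -/
def norm2 (ω : ℝ × ℝ → ℝ) : ℝ := (∫ x in H, ω x ^ 2) ^ ((1 : ℝ) / 2)

/-- The impulse `‖x₂ ω‖₁ = ∫_{ℝ²₊} x₂ |ω(x)| dx`. -/
def impulse (ω : ℝ × ℝ → ℝ) : ℝ := ∫ x in H, x.2 * |ω x|

/-- `ω ∈ (L¹ ∩ L²)(ℝ²₊)`. -/
def MemL1L2 (ω : ℝ × ℝ → ℝ) : Prop :=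
  Integrable ω (volume.restrict H) ∧ Integrable (fun x => ω x ^ 2) (volume.restrict H)

/-- Finiteness of the impulse `‖x₂ ω‖₁ < ∞`. -/
def ImpulseFinite (ω : ℝ × ℝ → ℝ) : Prop :=
  Integrable (fun x : ℝ × ℝ => x.2 * |ω x|) (volume.restrict H)

/-- The admissible class `K_M`: patches `ω = 1_A` a.e. on `ℝ²₊` with
impulse `∫_A x₂ = M` and mass `|A| ≤ 1`. -/
def memK (M : ℝ) (ω : ℝ × ℝ → ℝ) : Prop :=
  Integrable ω (volume.restrict H) ∧
  ∃ A : Set (ℝ × ℝ), A ⊆ H ∧ MeasurableSet A ∧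
    (∀ᵐ x ∂volume.restrict H, ω x = A.indicator (fun _ => (1 : ℝ)) x) ∧
    (∫ x in A, x.2) = M ∧ volume A ≤ 1

/-- The admissible class `K_{M,∞}`: patches `ω = 1_A` a.e. on `ℝ²₊` with
impulse `∫_A x₂ = M`, without any mass bound. -/
def memKinf (M : ℝ) (ω : ℝ × ℝ → ℝ) : Prop :=
  Integrable ω (volume.restrict H) ∧
  ∃ A : Set (ℝ × ℝ), A ⊆ H ∧ MeasurableSet A ∧
    (∀ᵐ x ∂volume.restrict H, ω x = A.indicator (fun _ => (1 : ℝ)) x) ∧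
    (∫ x in A, x.2) = M

/-- The relaxed admissible class `K̃_M`: measurable `0 ≤ ω ≤ 1` with
mass `≤ 1` and impulse `≤ M`. -/
def memKt (M : ℝ) (ω : ℝ × ℝ → ℝ) : Prop :=
  Integrable ω (volume.restrict H) ∧
  (∀ᵐ x ∂volume.restrict H, 0 ≤ ω x ∧ ω x ≤ 1) ∧
  norm1 ω ≤ 1 ∧
  Integrable (fun x : ℝ × ℝ => x.2 * |ω x|) (volume.restrict H) ∧
  impulse ω ≤ M

/-- The set of maximizers `S_M` of the energy over `K_M`. -/
def memS (M : ℝ) (ω : ℝ × ℝ → ℝ) : Prop :=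
  memK M ω ∧ ∀ ω' : ℝ × ℝ → ℝ, memK M ω' → energy ω' ≤ energy ω

/-- The maximal energy `I_M` over `K_M`. -/
def Isup (M : ℝ) : ℝ := sSup (energy '' {ω | memK M ω})

/-- The maximal energy `I_{1,∞}` over `K_{1,∞}`. -/
def IsupInf : ℝ := sSup (energy '' {ω | memKinf 1 ω})

/-- The Steiner symmetry condition for a set `Ω ⊆ ℝ²₊`. -/
def SteinerSet (Ω : Set (ℝ × ℝ)) : Prop :=
  (∀ x₁ x₂ : ℝ, 0 < x₂ → (((x₁, x₂) : ℝ × ℝ) ∈ Ω ↔ ((-x₁, x₂) : ℝ × ℝ) ∈ Ω)) ∧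
  (∀ x₂ : ℝ, 0 < x₂ → ∀ a b : ℝ, 0 ≤ a → a ≤ b →
    ((b, x₂) : ℝ × ℝ) ∈ Ω → ((a, x₂) : ℝ × ℝ) ∈ Ω)

/-- The Steiner symmetry condition for a nonnegative function on `ℝ²₊`. -/
def SteinerFn (f : ℝ × ℝ → ℝ) : Prop :=
  (∀ x₁ x₂ : ℝ, 0 < x₂ → f (x₁, x₂) = f (-x₁, x₂)) ∧
  (∀ x₂ : ℝ, 0 < x₂ → ∀ a b : ℝ, 0 ≤ a → a ≤ b → f (b, x₂) ≤ f (a, x₂))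


theorem G_nonneg {x y : ℝ × ℝ} (hx : x ∈ H) (hy : y ∈ H) : 0 ≤ G x y := by
  have hx' : 0 < x.2 := hx
  have hy' : 0 < y.2 := hy
  unfold G
  refine mul_nonneg (by positivity) (Real.log_nonneg ?_)
  have : 0 ≤ 4 * x.2 * y.2 / ((x.1 - y.1) ^ 2 + (x.2 - y.2) ^ 2) := by positivity
  linarith

theorem G_symm (x y : ℝ × ℝ) : G x y = G y x := by
  unfold G
  congr 3
  ring

theorem G_le {x y : ℝ × ℝ} (hx : x ∈ H) (hy : y ∈ H) :
    G x y ≤ √(x.2 * y.2) * ‖y - x‖⁻¹ := by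
  have hx' : 0 < x.2 := hx
  have hy' : 0 < y.2 := hy
  rcases eq_or_ne x y with rfl | hne
  · simp [G]
  have hN : 0 < ‖y - x‖ := norm_pos_iff.2 (sub_ne_zero.2 hne.symm)
  set N := ‖y - x‖ with hNdef
  set q := √(x.2 * y.2) with hq
  have hq0 : 0 < q := Real.sqrt_pos.2 (mul_pos hx' hy')
  have hqq : q ^ 2 = x.2 * y.2 := Real.sq_sqrt (mul_pos hx' hy').le
  have hD : N ^ 2 ≤ (x.1 - y.1) ^ 2 + (x.2 - y.2) ^ 2 := by
    rw [hNdef, Prod.norm_def, Prod.fst_sub, Prod.snd_sub, Real.norm_eq_abs, Real.norm_eq_abs]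
    rcases max_choice |y.1 - x.1| |y.2 - x.2| with h | h <;> rw [h, sq_abs] <;>
      nlinarith [sq_nonneg (x.1 - y.1), sq_nonneg (x.2 - y.2)]
  have ht : 4 * x.2 * y.2 / ((x.1 - y.1) ^ 2 + (x.2 - y.2) ^ 2) ≤ (2 * q / N) ^ 2 := by
    rw [div_pow, mul_pow, hqq]
    calc 4 * x.2 * y.2 / ((x.1 - y.1) ^ 2 + (x.2 - y.2) ^ 2) ≤ 4 * x.2 * y.2 / N ^ 2 := by gcongr
      _ = _ := by ring
  have ht0 : 0 ≤ 4 * x.2 * y.2 / ((x.1 - y.1) ^ 2 + (x.2 - y.2) ^ 2) := by positivity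
  have hv : 0 < 2 * q / N := by positivity
  have hlog : Real.log (1 + 4 * x.2 * y.2 / ((x.1 - y.1) ^ 2 + (x.2 - y.2) ^ 2))
      ≤ 2 * (2 * q / N) := by
    calc _ ≤ Real.log ((1 + 2 * q / N) ^ 2) := Real.log_le_log (by linarith) (by nlinarith)
      _ = 2 * Real.log (1 + 2 * q / N) := by rw [Real.log_pow]; norm_num
      _ ≤ _ := by nlinarith [Real.log_le_sub_one_of_pos (show 0 < 1 + 2 * q / N by linarith)]
  unfold G
  calc _ ≤ 1 / (4 * π) * (2 * (2 * q / N)) := by gcongr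
    _ = π⁻¹ * (q * N⁻¹) := by field_simp; ring
    _ ≤ 1 * (q * N⁻¹) := by
      gcongr
      exact inv_le_one_of_one_le₀ (by linarith [Real.pi_gt_three])
    _ = _ := one_mul _

theorem sqrt_le_one_add {t : ℝ} (ht : 0 ≤ t) : √t ≤ 1 + t := by
  rw [Real.sqrt_le_left (by linarith)]
  nlinarith

theorem G_le_far {x y : ℝ × ℝ} (hx : x ∈ H) (hy : y ∈ H) {δ : ℝ} (hδ : 0 < δ)
    (h : δ ≤ ‖y - x‖) : G x y ≤ √x.2 / δ * (1 + y.2) := by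
  have hx' : 0 < x.2 := hx
  have hy' : 0 < y.2 := hy
  calc G x y ≤ √(x.2 * y.2) * ‖y - x‖⁻¹ := G_le hx hy
    _ ≤ √(x.2 * y.2) * δ⁻¹ := by gcongr
    _ = √x.2 / δ * √y.2 := by rw [Real.sqrt_mul hx'.le]; ring
    _ ≤ _ := by gcongr; exact sqrt_le_one_add hy'.le

theorem G_le_near {x y : ℝ × ℝ} (hx : x ∈ H) (hy : y ∈ H) (h : ‖y - x‖ ≤ 1) :
    G x y ≤ (x.2 + 1) * ‖y - x‖⁻¹ := by
  have hx' : 0 < x.2 := hx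
  have hy' : 0 < y.2 := hy
  have h2 : y.2 ≤ x.2 + 1 := by
    have := (norm_snd_le (y - x)).trans h
    rw [Prod.snd_sub, Real.norm_eq_abs] at this
    linarith [le_abs_self (y.2 - x.2)]
  refine (G_le hx hy).trans ?_
  gcongr
  rw [Real.sqrt_le_left (by linarith)]
  nlinarith

theorem measurable_G : Measurable (Function.uncurry G) := by
  unfold G Function.uncurry
  fun_prop

theorem measurable_G_right (x : ℝ × ℝ) : Measurable (G x) :=
  measurable_G.comp measurable_prodMk_left

theorem measurableSet_H : MeasurableSet H := measurableSet_lt measurable_const measurable_snd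

theorem isOpen_H : IsOpen H := isOpen_lt continuous_const continuous_snd

theorem continuousAt_G_left {x y : ℝ × ℝ} (hx : x ∈ H) (hy : y ∈ H) (hne : x ≠ y) :
    ContinuousAt (fun z => G z y) x := by
  have hx' : 0 < x.2 := hx
  have hy' : 0 < y.2 := hy
  have hD : 0 < (x.1 - y.1) ^ 2 + (x.2 - y.2) ^ 2 := by
    by_contra! h
    refine hne (Prod.ext ?_ ?_) <;>
      nlinarith [sq_nonneg (x.1 - y.1), sq_nonneg (x.2 - y.2)]
  unfold G
  refine ContinuousAt.mul continuousAt_const (ContinuousAt.log ?_ ?_)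
  · exact continuousAt_const.add (ContinuousAt.div (by fun_prop) (by fun_prop) hD.ne')
  · positivity

theorem integrableOn_inv_norm_sub (x : ℝ × ℝ) (δ : ℝ) :
    IntegrableOn (fun y => ‖y - x‖⁻¹) (Metric.ball x δ) := by
  have h0 : IntegrableOn (fun z : ℝ × ℝ => ‖z‖⁻¹) (Metric.ball 0 δ) := by
    rw [integrableOn_fun_norm_addHaar volume (f := fun t => t⁻¹)]
    have : IntegrableOn (fun _ : ℝ => (1 : ℝ)) (Ioo 0 δ) := by simp
    refine this.congr_fun (fun t ht => ?_) measurableSet_Ioo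
    simp [ht.1.ne']
  have h := (measurePreserving_sub_right (volume : Measure (ℝ × ℝ)) x).integrableOn_comp_preimage
    (MeasurableEquiv.subRight x).measurableEmbedding |>.2 h0
  have hball : (fun y => y - x) ⁻¹' Metric.ball 0 δ = Metric.ball x δ := by
    ext y
    simp [dist_eq_norm]
  rwa [hball] at h

theorem integral_inv_norm_sub (x : ℝ × ℝ) {δ : ℝ} (hδ : 0 < δ) :
    ∫ y in Metric.ball x δ, ‖y - x‖⁻¹ = 8 * δ := by
  have h0 : ∫ z : ℝ × ℝ in Metric.ball 0 δ, ‖z‖⁻¹ = 8 * δ := by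
    rw [← integral_indicator Metric.isOpen_ball.measurableSet]
    have h1 : (Metric.ball (0 : ℝ × ℝ) δ).indicator (fun z : ℝ × ℝ => ‖z‖⁻¹)
        = fun z => (Iio δ).indicator (fun t : ℝ => t⁻¹) ‖z‖ := by
      ext z
      simp [indicator]
    have hball : volume.real (Metric.ball (0 : ℝ × ℝ) 1) = 4 := by
      rw [← Prod.mk_zero_zero, ← ball_prod_same (0 : ℝ) (0 : ℝ) 1, Measure.volume_eq_prod, measureReal_prod_prod,
        Real.volume_real_ball zero_le_one]
      norm_num
    have h2 : ∫ t in Ioi (0 : ℝ), t ^ (Module.finrank ℝ (ℝ × ℝ) - 1) •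
        (Iio δ).indicator (fun t : ℝ => t⁻¹) t = δ := by
      have : ∫ t in Ioi (0 : ℝ), t ^ (Module.finrank ℝ (ℝ × ℝ) - 1) •
        (Iio δ).indicator (fun t : ℝ => t⁻¹) t
          = ∫ t in Ioi (0 : ℝ), (Iio δ).indicator (fun _ => (1 : ℝ)) t := by
        refine setIntegral_congr_fun measurableSet_Ioi fun t ht => ?_
        have : t ≠ 0 := (show (0 : ℝ) < t from ht).ne'
        by_cases h : t < δ <;> simp [h, this]
      rw [this, setIntegral_indicator measurableSet_Iio]
      simp [Ioi_inter_Iio, hδ.le]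
    rw [h1, integral_fun_norm_addHaar, h2, hball]
    simp
    ring
  have h := (measurePreserving_sub_right (volume : Measure (ℝ × ℝ)) x).setIntegral_preimage_emb
    (MeasurableEquiv.subRight x).measurableEmbedding (fun z => ‖z‖⁻¹) (Metric.ball 0 δ)
  rw [← h0, ← h]
  congr 2
  ext y
  simp [dist_eq_norm]

/-- A measurable subset of the half plane with finite mass and finite impulse. -/
structure IsPatch (A : Set (ℝ × ℝ)) : Prop where
  measurableSet : MeasurableSet A
  subset : A ⊆ H
  finite : volume A ≠ ⊤
  integrable : IntegrableOn (fun y : ℝ × ℝ => y.2) A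

/-- The potential generated by the patch `A`. -/
def patchPot (A : Set (ℝ × ℝ)) (x : ℝ × ℝ) : ℝ := ∫ y in A, G x y

/-- The mutual interaction energy of two patches. -/
def interaction (A B : Set (ℝ × ℝ)) : ℝ := ∫ x in A, patchPot B x

/-- The integral of `1 + y₂` over the patch `A`. -/
def patchWeight (A : Set (ℝ × ℝ)) : ℝ := ∫ y in A, (1 + y.2)

namespace IsPatch

variable {A B C : Set (ℝ × ℝ)}

theorem mono (hA : IsPatch A) (hB : MeasurableSet B) (h : B ⊆ A) : IsPatch B :=
  ⟨hB, h.trans hA.subset, measure_ne_top_of_subset h hA.finite, hA.integrable.mono_set h⟩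

theorem union (hA : IsPatch A) (hB : IsPatch B) : IsPatch (A ∪ B) :=
  ⟨hA.measurableSet.union hB.measurableSet, union_subset hA.subset hB.subset,
    measure_union_ne_top hA.finite hB.finite, hA.integrable.union hB.integrable⟩

theorem congr (hA : IsPatch A) (hB : MeasurableSet B) (hBH : B ⊆ H) (h : A =ᵐ[volume] B) :
    IsPatch B :=
  ⟨hB, hBH, measure_congr h ▸ hA.finite, hA.integrable.congr_set_ae h.symm⟩

theorem integrableOn_weight (hA : IsPatch A) : IntegrableOn (fun y : ℝ × ℝ => 1 + y.2) A :=
  (integrableOn_const hA.finite).add hA.integrable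

theorem integrableOn_G_far (hA : IsPatch A) {x : ℝ × ℝ} (hx : x ∈ H) {δ : ℝ} (hδ : 0 < δ) :
    IntegrableOn (G x) (A \ Metric.ball x δ) := by
  have hA' := hA.mono (hA.measurableSet.diff Metric.isOpen_ball.measurableSet)
    (sdiff_subset (t := Metric.ball x δ))
  refine (hA'.integrableOn_weight.const_mul (√x.2 / δ)).mono'
    (measurable_G_right x).aestronglyMeasurable ?_
  filter_upwards [ae_restrict_mem hA'.measurableSet] with y hy
  rw [Real.norm_of_nonneg (G_nonneg hx (hA'.subset hy))]
  refine G_le_far hx (hA'.subset hy) hδ ?_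
  simpa [dist_eq_norm] using hy.2

theorem integrableOn_G_near (hA : IsPatch A) {x : ℝ × ℝ} (hx : x ∈ H) {δ : ℝ} (hδ : δ ≤ 1) :
    IntegrableOn (G x) (A ∩ Metric.ball x δ) := by
  have hA' := hA.mono (hA.measurableSet.inter Metric.isOpen_ball.measurableSet)
    (inter_subset_left (t := Metric.ball x δ))
  refine (((integrableOn_inv_norm_sub x δ).mono_set inter_subset_right).const_mul (x.2 + 1)).mono'
    (measurable_G_right x).aestronglyMeasurable ?_
  filter_upwards [ae_restrict_mem hA'.measurableSet] with y hy
  rw [Real.norm_of_nonneg (G_nonneg hx (hA'.subset hy))]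
  refine G_le_near hx (hA'.subset hy) ?_
  have := hy.2
  rw [Metric.mem_ball, dist_eq_norm] at this
  linarith

theorem integrableOn_G (hA : IsPatch A) {x : ℝ × ℝ} (hx : x ∈ H) : IntegrableOn (G x) A := by
  rw [← inter_union_sdiff A (Metric.ball x 1)]
  exact (hA.integrableOn_G_near hx le_rfl).union (hA.integrableOn_G_far hx one_pos)

theorem patchPot_near_le (hA : IsPatch A) {x : ℝ × ℝ} (hx : x ∈ H) {δ : ℝ} (hδ : 0 < δ)
    (hδ1 : δ ≤ 1) : patchPot (A ∩ Metric.ball x δ) x ≤ 8 * δ * (x.2 + 1) := by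
  have hx' : 0 < x.2 := hx
  have hA' := hA.mono (hA.measurableSet.inter Metric.isOpen_ball.measurableSet)
    (inter_subset_left (t := Metric.ball x δ))
  have hint := integrableOn_inv_norm_sub x δ
  calc patchPot (A ∩ Metric.ball x δ) x
      ≤ ∫ y in A ∩ Metric.ball x δ, (x.2 + 1) * ‖y - x‖⁻¹ := by
        refine setIntegral_mono_on (hA'.integrableOn_G hx)
          ((hint.mono_set inter_subset_right).const_mul _) hA'.measurableSet fun y hy => ?_
        refine G_le_near hx (hA'.subset hy) ?_
        have := hy.2
        rw [Metric.mem_ball, dist_eq_norm] at this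
        linarith
    _ ≤ ∫ y in Metric.ball x δ, (x.2 + 1) * ‖y - x‖⁻¹ :=
        setIntegral_mono_set (hint.const_mul _) (Eventually.of_forall fun y => by
          have := norm_nonneg (y - x)
          simp only [Pi.zero_apply]
          positivity) inter_subset_right.eventuallyLE
    _ = 8 * δ * (x.2 + 1) := by
        rw [integral_const_mul, integral_inv_norm_sub x hδ]
        ring

theorem patchPot_nonneg (hA : IsPatch A) {x : ℝ × ℝ} (hx : x ∈ H) : 0 ≤ patchPot A x :=
  setIntegral_nonneg hA.measurableSet fun _ hy => G_nonneg hx (hA.subset hy)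

theorem weight_nonneg (hA : IsPatch A) : 0 ≤ patchWeight A :=
  setIntegral_nonneg hA.measurableSet fun y hy => by
    have : 0 < y.2 := hA.subset hy
    linarith

theorem patchPot_far_le (hA : IsPatch A) {x : ℝ × ℝ} (hx : x ∈ H) {δ : ℝ} (hδ : 0 < δ) :
    patchPot (A \ Metric.ball x δ) x ≤ √x.2 / δ * patchWeight A := by
  have hA' := hA.mono (hA.measurableSet.diff Metric.isOpen_ball.measurableSet)
    (sdiff_subset (t := Metric.ball x δ))
  calc patchPot (A \ Metric.ball x δ) x
      ≤ ∫ y in A \ Metric.ball x δ, √x.2 / δ * (1 + y.2) := by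
        refine setIntegral_mono_on (hA'.integrableOn_G hx)
          (hA'.integrableOn_weight.const_mul _) hA'.measurableSet fun y hy => ?_
        refine G_le_far hx (hA'.subset hy) hδ ?_
        simpa [dist_eq_norm] using hy.2
    _ ≤ ∫ y in A, √x.2 / δ * (1 + y.2) := by
        refine setIntegral_mono_set (hA.integrableOn_weight.const_mul _) ?_
          sdiff_subset.eventuallyLE
        filter_upwards [ae_restrict_mem hA.measurableSet] with y hy
        have : 0 < y.2 := hA.subset hy
        simp only [Pi.zero_apply]
        positivity
    _ = _ := integral_const_mul _ _

theorem patchPot_union (hA : IsPatch A) (hB : IsPatch B) (h : Disjoint A B) {x : ℝ × ℝ}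
    (hx : x ∈ H) : patchPot (A ∪ B) x = patchPot A x + patchPot B x :=
  setIntegral_union h hB.measurableSet (hA.integrableOn_G hx) (hB.integrableOn_G hx)

theorem patchPot_split (hA : IsPatch A) (hB : MeasurableSet B) {x : ℝ × ℝ} (hx : x ∈ H) :
    patchPot A x = patchPot (A ∩ B) x + patchPot (A \ B) x := by
  rw [← (hA.mono (hA.measurableSet.inter hB) inter_subset_left).patchPot_union
    (hA.mono (hA.measurableSet.diff hB) sdiff_subset)
    (disjoint_sdiff_inter.symm) hx, inter_union_sdiff]

theorem patchPot_le (hA : IsPatch A) {x : ℝ × ℝ} (hx : x ∈ H) {δ : ℝ} (hδ : 0 < δ)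
    (hδ1 : δ ≤ 1) : patchPot A x ≤ 8 * δ * (x.2 + 1) + √x.2 / δ * patchWeight A := by
  rw [hA.patchPot_split (Metric.isOpen_ball (x := x) (ε := δ)).measurableSet hx]
  exact add_le_add (hA.patchPot_near_le hx hδ hδ1) (hA.patchPot_far_le hx hδ)

theorem continuousAt_patchPot_far (hA : IsPatch A) {x : ℝ × ℝ} (hx : x ∈ H) {δ : ℝ}
    (hδ : 0 < δ) : ContinuousAt (patchPot (A \ Metric.ball x (2 * δ))) x := by
  have hA' := hA.mono (hA.measurableSet.diff Metric.isOpen_ball.measurableSet)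
    (sdiff_subset (t := Metric.ball x (2 * δ)))
  have hsqrt : ∀ᶠ z in 𝓝 x, √z.2 < √x.2 + 1 :=
    ContinuousAt.eventually_lt (f := fun z : ℝ × ℝ => √z.2) (by fun_prop) continuousAt_const
      (by simp)
  refine continuousAt_of_dominated (bound := fun y => (√x.2 + 1) / δ * (1 + y.2))
    (Eventually.of_forall fun z => (measurable_G_right z).aestronglyMeasurable) ?_
    (hA'.integrableOn_weight.const_mul _) ?_
  · filter_upwards [hsqrt, isOpen_H.mem_nhds hx, Metric.ball_mem_nhds x hδ] with z hz hzH hzx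
    filter_upwards [ae_restrict_mem hA'.measurableSet] with y hy
    have hy' : 0 < y.2 := hA'.subset hy
    rw [Real.norm_of_nonneg (G_nonneg hzH (hA'.subset hy))]
    have hyx : 2 * δ ≤ dist y x := by simpa using hy.2
    have hzx' : dist z x < δ := hzx
    have hyz : δ ≤ ‖y - z‖ := by
      rw [← dist_eq_norm]
      linarith [dist_triangle y z x]
    refine (G_le_far hzH (hA'.subset hy) hδ hyz).trans ?_
    gcongr
  · filter_upwards [ae_restrict_mem hA'.measurableSet] with y hy
    refine continuousAt_G_left hx (hA'.subset hy) ?_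
    rintro rfl
    exact hy.2 (Metric.mem_ball_self (by positivity))

theorem patchPot_mono (hA : IsPatch A) (h : B ⊆ A) {x : ℝ × ℝ}
    (hx : x ∈ H) : patchPot B x ≤ patchPot A x := by
  refine setIntegral_mono_set (hA.integrableOn_G hx) ?_ h.eventuallyLE
  filter_upwards [ae_restrict_mem hA.measurableSet] with y hy
  exact G_nonneg hx (hA.subset hy)

theorem continuousOn_patchPot (hA : IsPatch A) : ContinuousOn (patchPot A) H := by
  intro x hx
  refine ContinuousAt.continuousWithinAt ?_
  have hx' : 0 < x.2 := hx
  rw [Metric.continuousAt_iff']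
  intro ε hε
  obtain ⟨δ, hδ, hδ1, hδε⟩ : ∃ δ : ℝ, 0 < δ ∧ 3 * δ ≤ 1 ∧ 24 * δ * (x.2 + 2) < ε / 4 := by
    refine ⟨min (1 / 3) (ε / (100 * (x.2 + 2))), by positivity, ?_, ?_⟩
    · linarith [min_le_left (1 / 3) (ε / (100 * (x.2 + 2)))]
    · calc 24 * min (1 / 3) (ε / (100 * (x.2 + 2))) * (x.2 + 2)
          ≤ 24 * (ε / (100 * (x.2 + 2))) * (x.2 + 2) := by
            gcongr
            exact min_le_right _ _
        _ = 24 * ε / 100 := by field_simp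
        _ < ε / 4 := by linarith
  have hball : MeasurableSet (Metric.ball x (2 * δ)) := Metric.isOpen_ball.measurableSet
  have hnear : ∀ z ∈ H, dist z x < δ → patchPot (A ∩ Metric.ball x (2 * δ)) z < ε / 4 := by
    intro z hz hzx
    have hzx2 : z.2 ≤ x.2 + 1 := by
      have h1 : dist z.2 x.2 ≤ dist z x := le_max_right _ _
      rw [Real.dist_eq] at h1
      linarith [le_abs_self (z.2 - x.2)]
    have hsub : A ∩ Metric.ball x (2 * δ) ⊆ A ∩ Metric.ball z (3 * δ) := by
      refine inter_subset_inter_right _ (Metric.ball_subset_ball' ?_)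
      rw [dist_comm]
      linarith
    have hAz := hA.mono (hA.measurableSet.inter Metric.isOpen_ball.measurableSet)
      (inter_subset_left (t := Metric.ball z (3 * δ)))
    calc patchPot (A ∩ Metric.ball x (2 * δ)) z ≤ patchPot (A ∩ Metric.ball z (3 * δ)) z :=
          hAz.patchPot_mono hsub hz
      _ ≤ 8 * (3 * δ) * (z.2 + 1) := hA.patchPot_near_le hz (by linarith) hδ1
      _ ≤ 24 * δ * (x.2 + 2) := by nlinarith
      _ < ε / 4 := hδε
  have hA1 := hA.mono (hA.measurableSet.inter hball) inter_subset_left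
  have hfar := Metric.continuousAt_iff'.1 (hA.continuousAt_patchPot_far hx hδ) (ε / 4)
    (by positivity)
  filter_upwards [hfar, isOpen_H.mem_nhds hx, Metric.ball_mem_nhds x hδ] with z hz hzH hzx
  rw [Real.dist_eq, abs_lt] at hz ⊢
  have h1 := hnear z hzH hzx
  have h2 := hnear x hx (by simpa using hδ)
  have h3 := hA1.patchPot_nonneg hzH
  have h4 := hA1.patchPot_nonneg hx
  rw [hA.patchPot_split hball hx, hA.patchPot_split hball hzH]
  constructor <;> linarith [hz.1, hz.2]

theorem integrableOn_patchPot (hA : IsPatch A) (hB : IsPatch B) :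
    IntegrableOn (patchPot A) B := by
  refine (hB.integrableOn_weight.const_mul (8 + patchWeight A)).mono'
    ((hA.continuousOn_patchPot.mono hB.subset).aestronglyMeasurable hB.measurableSet) ?_
  filter_upwards [ae_restrict_mem hB.measurableSet] with x hx
  have hxH := hB.subset hx
  have hx' : 0 < x.2 := hxH
  rw [Real.norm_of_nonneg (hA.patchPot_nonneg hxH)]
  have h1 := hA.patchPot_le hxH one_pos le_rfl
  have h2 := sqrt_le_one_add hx'.le
  have h3 := hA.weight_nonneg
  nlinarith

theorem interaction_union_left (hA : IsPatch A) (hB : IsPatch B) (hC : IsPatch C)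
    (h : Disjoint A B) : interaction (A ∪ B) C = interaction A C + interaction B C :=
  setIntegral_union h hB.measurableSet (hC.integrableOn_patchPot hA) (hC.integrableOn_patchPot hB)

theorem interaction_comm (hA : IsPatch A) (hB : IsPatch B) :
    interaction A B = interaction B A := by
  have hint : Integrable (Function.uncurry G) ((volume.restrict A).prod (volume.restrict B)) := by
    rw [integrable_prod_iff measurable_G.aestronglyMeasurable]
    constructor
    · filter_upwards [ae_restrict_mem hA.measurableSet] with x hx
      exact hB.integrableOn_G (hA.subset hx)
    · refine (hB.integrableOn_patchPot hA).congr ?_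
      filter_upwards [ae_restrict_mem hA.measurableSet] with x hx
      refine setIntegral_congr_fun hB.measurableSet fun y hy => ?_
      exact (Real.norm_of_nonneg (G_nonneg (hA.subset hx) (hB.subset hy))).symm
  unfold interaction patchPot
  rw [integral_integral_swap hint]
  simp only [G_symm]

theorem interaction_union_right (hA : IsPatch A) (hB : IsPatch B) (hC : IsPatch C)
    (h : Disjoint A B) : interaction C (A ∪ B) = interaction C A + interaction C B := by
  rw [hC.interaction_comm (hA.union hB), hA.interaction_union_left hB hC h,
    hC.interaction_comm hA, hC.interaction_comm hB]

theorem interaction_nonneg (hA : IsPatch A) (hB : IsPatch B) : 0 ≤ interaction A B :=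
  setIntegral_nonneg hA.measurableSet fun _ hx => hB.patchPot_nonneg (hA.subset hx)

theorem interaction_exchange (hA : IsPatch A) (hB : IsPatch B) (hC : IsPatch C) (hBA : B ⊆ A)
    (hCA : Disjoint A C) :
    interaction A A + 2 * (interaction C A - interaction B A - interaction C B)
      ≤ interaction ((A \ B) ∪ C) ((A \ B) ∪ C) := by
  have hD : IsPatch (A \ B) := hA.mono (hA.measurableSet.diff hB.measurableSet) sdiff_subset
  have hDB : Disjoint (A \ B) B := disjoint_sdiff_left
  have hDC : Disjoint (A \ B) C := hCA.mono_left sdiff_subset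
  have hAeq : A = (A \ B) ∪ B := (sdiff_union_of_subset hBA).symm
  have hUA : ∀ {X}, IsPatch X → interaction X A = interaction X (A \ B) + interaction X B := by
    intro X hX
    conv_lhs => rw [hAeq]
    exact hD.interaction_union_right hB hX hDB
  have hAA : interaction A A = interaction (A \ B) A + interaction B A := by
    conv_lhs => rw [hAeq, hD.interaction_union_left hB (hD.union hB) hDB]
    rw [← hAeq]
  rw [hAA, hUA hD, hUA hB, hUA hC, hD.interaction_union_left hC (hD.union hC) hDC,
    hD.interaction_union_right hC hD hDC, hD.interaction_union_right hC hC hDC,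
    hD.interaction_comm hC, hD.interaction_comm hB]
  linarith [hB.interaction_nonneg hB, hC.interaction_nonneg hC]

end IsPatch

theorem Gpot_eq_patchPot {ω : ℝ × ℝ → ℝ} {A : Set (ℝ × ℝ)} (hA : MeasurableSet A) (hAH : A ⊆ H)
    (h : ∀ᵐ x ∂volume.restrict H, ω x = A.indicator (fun _ => (1 : ℝ)) x) :
    Gpot ω = patchPot A := by
  ext x
  have : Gpot ω x = ∫ y in H, A.indicator (G x) y := by
    refine integral_congr_ae ?_
    filter_upwards [h] with y hy
    rw [hy]
    by_cases hyA : y ∈ A <;> simp [hyA]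
  rw [this, setIntegral_indicator hA, inter_eq_right.2 hAH, patchPot]

theorem energy_eq_interaction {ω : ℝ × ℝ → ℝ} {A : Set (ℝ × ℝ)} (hA : MeasurableSet A)
    (hAH : A ⊆ H) (h : ∀ᵐ x ∂volume.restrict H, ω x = A.indicator (fun _ => (1 : ℝ)) x) :
    energy ω = 1 / 2 * interaction A A := by
  have hinner : ∀ x, ∫ y in H, G x y * ω x * ω y = ω x * patchPot A x := by
    intro x
    rw [← Gpot_eq_patchPot hA hAH h, Gpot, ← integral_const_mul]
    congr 1
    ext y
    ring
  have : ∫ x in H, ω x * patchPot A x = ∫ x in H, A.indicator (patchPot A) x := by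
    refine integral_congr_ae ?_
    filter_upwards [h] with y hy
    rw [hy]
    by_cases hyA : y ∈ A <;> simp [hyA]
  simp only [energy, hinner]
  rw [this, setIntegral_indicator hA, inter_eq_right.2 hAH, interaction]

theorem norm1_eq_measureReal {ω : ℝ × ℝ → ℝ} {A : Set (ℝ × ℝ)} (hA : MeasurableSet A)
    (hAH : A ⊆ H) (h : ∀ᵐ x ∂volume.restrict H, ω x = A.indicator (fun _ => (1 : ℝ)) x) :
    norm1 ω = volume.real A := by
  have : norm1 ω = ∫ y in H, A.indicator (fun _ => (1 : ℝ)) y := by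
    refine integral_congr_ae ?_
    filter_upwards [h] with y hy
    rw [hy]
    by_cases hyA : y ∈ A <;> simp [hyA]
  rw [this, setIntegral_indicator hA, inter_eq_right.2 hAH]
  simp

/-- The rectangle with lower left corner `a`, width `w` and height `h`. -/
def rect (a : ℝ × ℝ) (w h : ℝ) : Set (ℝ × ℝ) := Icc a.1 (a.1 + w) ×ˢ Icc a.2 (a.2 + h)

theorem measurableSet_rect (a : ℝ × ℝ) (w h : ℝ) : MeasurableSet (rect a w h) :=
  measurableSet_Icc.prod measurableSet_Icc

theorem rect_subset_ball (a : ℝ × ℝ) {w h r : ℝ} (hw : w < r) (hh : h < r) :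
    rect a w h ⊆ Metric.ball a r := by
  rintro y ⟨⟨h1, h2⟩, h3, h4⟩
  rw [Metric.mem_ball, Prod.dist_eq, max_lt_iff, Real.dist_eq, Real.dist_eq, abs_lt, abs_lt]
  refine ⟨⟨?_, ?_⟩, ?_, ?_⟩ <;> linarith

theorem isCompact_rect (a : ℝ × ℝ) (w h : ℝ) : IsCompact (rect a w h) :=
  isCompact_Icc.prod isCompact_Icc

theorem isPatch_rect {a : ℝ × ℝ} (ha : a ∈ H) (w h : ℝ) : IsPatch (rect a w h) where
  measurableSet := measurableSet_rect a w h
  subset _ hy := lt_of_lt_of_le (show 0 < a.2 from ha) hy.2.1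
  finite := (isCompact_rect a w h).measure_lt_top.ne
  integrable := continuous_snd.continuousOn.integrableOn_compact (isCompact_rect a w h)

theorem measureReal_rect (a : ℝ × ℝ) {w h : ℝ} (hw : 0 ≤ w) (hh : 0 ≤ h) :
    volume.real (rect a w h) = w * h := by
  rw [rect, Measure.volume_eq_prod, measureReal_prod_prod, Real.volume_real_Icc,
    Real.volume_real_Icc]
  simp [hw, hh]

theorem impulse_rect (a : ℝ × ℝ) {w h : ℝ} (hw : 0 ≤ w) (hh : 0 ≤ h) :
    ∫ y in rect a w h, y.2 = w * h * (2 * a.2 + h) / 2 := by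
  have := setIntegral_prod_mul (μ := volume) (ν := volume) (fun _ : ℝ => (1 : ℝ))
    (fun t : ℝ => t) (Icc a.1 (a.1 + w)) (Icc a.2 (a.2 + h))
  simp only [one_mul] at this
  rw [rect, Measure.volume_eq_prod, this, setIntegral_const, Real.volume_real_Icc,
    integral_Icc_eq_integral_Ioc, ← intervalIntegral.integral_of_le (by linarith), integral_id,
    max_eq_left (by linarith)]
  simp
  ring

namespace IsPatch

variable {A B C : Set (ℝ × ℝ)}

/-- On every vertical line, the stream function with positive flux constant is negative both near
the boundary and near infinity, so it takes every small value of either sign. -/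
theorem exists_levels (hA : IsPatch A) {W γ : ℝ} (hW : 0 < W) (hγ : 0 < γ) {a : ℝ × ℝ}
    (ha : a ∈ H) (hapos : 0 < patchPot A a - W * a.2 - γ) :
    ∃ p q ε₀ : ℝ, 0 < p ∧ p < q ∧ 0 < ε₀ ∧ ∀ ε, 0 < ε → ε ≤ ε₀ →
      (∃ c ∈ H, c.2 < p ∧ patchPot A c - W * c.2 - γ = -ε) ∧
      ∃ b ∈ H, q < b.2 ∧ patchPot A b - W * b.2 - γ = ε := by
  have ha' : 0 < a.2 := ha
  set f : ℝ → ℝ := fun s => patchPot A (a.1, s) - W * s - γ with hf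
  have hfc : ContinuousOn f (Ioi 0) := by
    refine ((hA.continuousOn_patchPot.comp (Continuous.continuousOn (by fun_prop)) ?_).sub
      (by fun_prop)).sub continuousOn_const
    intro s hs
    exact hs
  have hfa : 0 < f a.2 := hapos
  obtain ⟨q, hq, hfq⟩ : ∃ q, a.2 < q ∧ 0 < f q := by
    have h1 : ∀ᶠ s in 𝓝 a.2, 0 < f s :=
      (hfc.continuousAt (Ioi_mem_nhds ha')).eventually_const_lt hfa
    have h2 : ∀ᶠ s in 𝓝[>] a.2, 0 < f s := h1.filter_mono nhdsWithin_le_nhds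
    exact (eventually_mem_nhdsWithin.and h2).exists
  have hD : 0 ≤ patchWeight A := hA.weight_nonneg
  obtain ⟨s₀, hs₀, hs₀a, hfs₀⟩ : ∃ s, 0 < s ∧ s < a.2 ∧ f s < -(γ / 2) := by
    set δ := min 1 (γ / 32) with hδ
    have hδ0 : 0 < δ := by positivity
    have h1 : ∀ᶠ s in 𝓝 (0 : ℝ), 8 * δ * (s + 1) + √s / δ * patchWeight A < γ / 2 := by
      refine ContinuousAt.eventually_lt (by fun_prop) continuousAt_const ?_
      simp
      linarith [min_le_right 1 (γ / 32)]
    have h2 : ∀ᶠ s in 𝓝[>] (0 : ℝ), 8 * δ * (s + 1) + √s / δ * patchWeight A < γ / 2 :=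
      h1.filter_mono nhdsWithin_le_nhds
    have h3 : ∀ᶠ s in 𝓝[>] (0 : ℝ), s < a.2 :=
      (eventually_lt_nhds ha').filter_mono nhdsWithin_le_nhds
    obtain ⟨s, ⟨hs, hsa⟩, hs2⟩ := ((eventually_mem_nhdsWithin.and h3).and h2).exists
    have hs' : 0 < s := hs
    refine ⟨s, hs', hsa, ?_⟩
    have := hA.patchPot_le (x := (a.1, s)) hs' hδ0 (min_le_left _ _)
    have h4 : 0 < W * s := mul_pos hW hs'
    simp only [hf]
    simp only at this
    linarith
  obtain ⟨s₁, hs₁, hfs₁⟩ : ∃ s, q < s ∧ f s < 0 := by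
    set δ := min 1 (W / 16) with hδ
    have hδ0 : 0 < δ := by positivity
    have hδW : 8 * δ ≤ W / 2 := by linarith [min_le_right 1 (W / 16)]
    set D := patchWeight A / δ with hDdef
    have hD0 : 0 ≤ D := by positivity
    have hDW : 0 ≤ 2 * D / W := by positivity
    set u := 2 * D / W + 2 + q with hu
    have hq0 : 0 < q := ha'.trans hq
    have hu2 : 2 < u := by linarith
    have huW : 2 * (D + W) ≤ W * u := by
      have : W * u = 2 * D + 2 * W + W * q := by rw [hu]; field_simp
      nlinarith
    have hu0 : 0 < u ^ 2 := by positivity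
    refine ⟨u ^ 2, by nlinarith, ?_⟩
    have := hA.patchPot_le (x := (a.1, u ^ 2)) hu0 hδ0 (min_le_left _ _)
    simp only [Real.sqrt_sq (by linarith : 0 ≤ u)] at this
    have h1 : u / δ * patchWeight A = u * D := by rw [hDdef]; ring
    rw [h1] at this
    have h2 : 8 * δ * (u ^ 2 + 1) ≤ W / 2 * (u ^ 2 + 1) := by gcongr
    simp only [hf]
    nlinarith
  refine ⟨a.2, q, min (γ / 2) (f q / 2), ha', hq, by positivity, fun ε hε hε₀ => ⟨?_, ?_⟩⟩
  · obtain ⟨s, hs, hfs⟩ := intermediate_value_Icc hs₀a.le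
      (hfc.mono fun s hs => hs₀.trans_le hs.1)
      (show -ε ∈ Icc (f s₀) (f a.2) from
        ⟨by linarith [min_le_left (γ / 2) (f q / 2)], by linarith⟩)
    refine ⟨(a.1, s), hs₀.trans_le hs.1, lt_of_le_of_ne hs.2 ?_, hfs⟩
    rintro (rfl : s = a.2)
    linarith
  · obtain ⟨s, hs, hfs⟩ := intermediate_value_Icc' hs₁.le
      (hfc.mono fun s hs => (ha'.trans hq).trans_le hs.1)
      (show ε ∈ Icc (f s₁) (f q) from
        ⟨by linarith, by linarith [min_le_right (γ / 2) (f q / 2)]⟩)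
    refine ⟨(a.1, s), (ha'.trans hq).trans_le hs.1, lt_of_le_of_ne hs.1 ?_, hfs⟩
    rintro rfl
    linarith [min_le_right (γ / 2) (f q / 2)]

/-- First order optimality: exchanging a part `B` of a maximizing patch `A` for a set `C` of the
same impulse, located at distance at least `d` from `B`, cannot gain energy. The stream function is
at most `ε` on `B` and at least `-ε` on `C`. -/
theorem exchange_estimate (hA : IsPatch A) (hB : IsPatch B) (hC : IsPatch C) {W γ ε K : ℝ}
    (himp : ∫ y in C, y.2 = ∫ y in B, y.2)
    (hBε : ∀ y ∈ B, patchPot A y - W * y.2 - γ ≤ ε)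
    (hCε : ∀ y ∈ C, -ε ≤ patchPot A y - W * y.2 - γ)
    (hK : ∀ x ∈ C, ∀ y ∈ B, G x y ≤ K)
    (hmax : interaction C A - interaction B A ≤ interaction C B) :
    (γ - ε) * volume.real C ≤ (γ + ε) * volume.real B + K * volume.real B * volume.real C := by
  have hlin : ∀ {X : Set (ℝ × ℝ)} (t : ℝ), IsPatch X →
      IntegrableOn (fun y : ℝ × ℝ => W * y.2 + t) X ∧
      ∫ y in X, (W * y.2 + t) = W * (∫ y in X, y.2) + t * volume.real X := by
    intro X t hX
    have h1 := hX.integrable.const_mul W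
    have h2 : IntegrableOn (fun _ : ℝ × ℝ => t) X := integrableOn_const hX.finite
    refine ⟨h1.add h2, ?_⟩
    rw [integral_add h1 h2, integral_const_mul, setIntegral_const, smul_eq_mul, mul_comm t]
  have h1 : W * (∫ y in C, y.2) + (γ - ε) * volume.real C ≤ interaction C A := by
    rw [← (hlin (γ - ε) hC).2]
    refine setIntegral_mono_on (hlin _ hC).1 (hA.integrableOn_patchPot hC) hC.measurableSet
      fun y hy => ?_
    linarith [hCε y hy]
  have h2 : interaction B A ≤ W * (∫ y in B, y.2) + (γ + ε) * volume.real B := by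
    rw [← (hlin (γ + ε) hB).2]
    refine setIntegral_mono_on (hA.integrableOn_patchPot hB) (hlin _ hB).1 hB.measurableSet
      fun y hy => ?_
    linarith [hBε y hy]
  have h3 : interaction C B ≤ K * volume.real B * volume.real C := by
    calc interaction C B ≤ ∫ _ in C, K * volume.real B := by
          refine setIntegral_mono_on (hB.integrableOn_patchPot hC)
            (integrableOn_const hC.finite) hC.measurableSet fun x hx => ?_
          calc patchPot B x ≤ ∫ _ in B, K :=
                setIntegral_mono_on (hB.integrableOn_G (hC.subset hx))
                  (integrableOn_const hB.finite) hB.measurableSet (hK x hx)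
            _ = K * volume.real B := by rw [setIntegral_const, smul_eq_mul, mul_comm]
      _ = _ := by rw [setIntegral_const, smul_eq_mul, mul_comm]
  rw [himp] at h1
  linarith

/-- A maximizing superlevel set of the stream function with mass less than one has vanishing flux
constant. -/
theorem flux_eq_zero_of_isMaximal (hA : IsPatch A) {W γ : ℝ} (hW : 0 < W) (hγ : 0 ≤ γ)
    (hAeq : A = {y ∈ H | 0 < patchPot A y - W * y.2 - γ}) (hne : A.Nonempty)
    (hvol : volume.real A < 1)
    (hmax : ∀ A', IsPatch A' → ∫ y in A', y.2 = ∫ y in A, y.2 → volume.real A' ≤ 1 →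
      interaction A' A' ≤ interaction A A) : γ = 0 := by
  by_contra hγ0
  have hγ : 0 < γ := lt_of_le_of_ne hγ (Ne.symm hγ0)
  obtain ⟨a, ha⟩ := hne
  obtain ⟨p, q, ε₀, hp, hpq, hε₀, hlev⟩ :=
    hA.exists_levels hW hγ (hA.subset ha) (by rw [hAeq] at ha; exact ha.2)
  have hψc : ContinuousOn (fun y => patchPot A y - W * y.2 - γ) H :=
    (hA.continuousOn_patchPot.sub (by fun_prop)).sub continuousOn_const
  set ψ : ℝ × ℝ → ℝ := fun y => patchPot A y - W * y.2 - γ with hψ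
  obtain ⟨ε, hε, hεε₀, hεγ⟩ : ∃ ε, 0 < ε ∧ ε ≤ ε₀ ∧ 4 * ε * (q + p) ≤ γ * (q - p) := by
    have hqp : 0 < q - p := by linarith
    have hq : 0 < q := hp.trans hpq
    refine ⟨min ε₀ (γ * (q - p) / (4 * (q + p))), by positivity, min_le_left _ _, ?_⟩
    calc 4 * min ε₀ (γ * (q - p) / (4 * (q + p))) * (q + p)
        ≤ 4 * (γ * (q - p) / (4 * (q + p))) * (q + p) := by
          gcongr
          exact min_le_right _ _
      _ = γ * (q - p) := by field_simp
  obtain ⟨⟨c, hcH, hcp, hψcε⟩, b, hbH, hqb, hψbε⟩ := hlev ε hε hεε₀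
  have hψcε : ψ c = -ε := hψcε
  have hψbε : ψ b = ε := hψbε
  obtain ⟨rc, hrc, hcball⟩ : ∃ r > 0, ∀ y ∈ Metric.ball c r,
      y ∈ H ∧ y.2 < p ∧ -(2 * ε) < ψ y ∧ ψ y < 0 := by
    have hc := hψc.continuousAt (isOpen_H.mem_nhds hcH)
    refine Metric.eventually_nhds_iff_ball.1 ?_
    filter_upwards [isOpen_H.mem_nhds hcH, continuousAt_snd.eventually_lt_const hcp,
      hc.eventually_const_lt (show -(2 * ε) < ψ c by linarith),
      hc.eventually_lt_const (show ψ c < 0 by linarith)] with y h1 h2 h3 h4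
    exact ⟨h1, h2, h3, h4⟩
  obtain ⟨rb, hrb, hbball⟩ : ∃ r > 0, ∀ y ∈ Metric.ball b r,
      y ∈ H ∧ q < y.2 ∧ y.2 < b.2 + 1 ∧ 0 < ψ y ∧ ψ y < 2 * ε := by
    have hb := hψc.continuousAt (isOpen_H.mem_nhds hbH)
    refine Metric.eventually_nhds_iff_ball.1 ?_
    filter_upwards [isOpen_H.mem_nhds hbH, continuousAt_snd.eventually_const_lt hqb,
      continuousAt_snd.eventually_lt_const (show b.2 < b.2 + 1 by linarith),
      hb.eventually_const_lt (show 0 < ψ b by linarith),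
      hb.eventually_lt_const (show ψ b < 2 * ε by linarith)] with y h1 h2 h3 h4 h5
    exact ⟨h1, h2, h3, h4, h5⟩
  have hb0 : 0 < b.2 := hbH
  have hc0 : 0 < c.2 := hcH
  set h := min rb (min rc (p - c.2)) / 2 with hh
  have hpc : 0 < p - c.2 := by linarith
  have hh0 : 0 < h := by positivity
  have hhrb : h < rb := by
    linarith [min_le_left rb (min rc (p - c.2))]
  have hhrc : h < rc := by
    linarith [min_le_right rb (min rc (p - c.2)), min_le_left rc (p - c.2)]
  have hhp : h < p - c.2 := by
    linarith [min_le_right rb (min rc (p - c.2)), min_le_right rc (p - c.2)]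
  set k := (2 * b.2 + h) / (2 * c.2 + h) with hk
  have hk0 : 0 < k := by positivity
  have hkmul : k * (2 * c.2 + h) = 2 * b.2 + h := by rw [hk]; field_simp
  have hkp : q < k * p := by
    have : k * (2 * c.2 + h) < k * (2 * p) := by gcongr; linarith
    linarith
  set K := √(p * (b.2 + 1)) * (q - p)⁻¹ with hK
  have hK0 : 0 ≤ K := by
    have : 0 ≤ (q - p)⁻¹ := inv_nonneg.2 (by linarith)
    positivity
  have hgain : 0 < (γ - 2 * ε) * k - (γ + 2 * ε) := by
    have h2ε : 0 < γ - 2 * ε := by nlinarith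
    have h1 : (γ - 2 * ε) * q < (γ - 2 * ε) * (k * p) := by gcongr
    have h2 : (γ + 2 * ε) * p < (γ - 2 * ε) * q := by nlinarith
    have h3 : 0 < ((γ - 2 * ε) * k - (γ + 2 * ε)) * p := by nlinarith
    exact pos_of_mul_pos_left h3 hp.le
  have hsmall : ∀ m d : ℝ, 0 < d → ∀ᶠ t in 𝓝[>] (0 : ℝ), t * m < d := by
    intro m d hd
    refine Eventually.filter_mono nhdsWithin_le_nhds ?_
    exact ContinuousAt.eventually_lt (by fun_prop) continuousAt_const (by simpa using hd)
  obtain ⟨t, ht, htb, htc, htvol, htK⟩ :=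
    ((eventually_mem_nhdsWithin (a := (0 : ℝ)) (s := Ioi 0)).and <| (hsmall 1 rb hrb).and <|
      (hsmall k rc hrc).and <| (hsmall (k * h) (1 - volume.real A) (by linarith)).and <|
      hsmall (K * k * h) _ hgain).exists
  have ht0 : 0 < t := ht
  rw [mul_one] at htb
  have hB := isPatch_rect hbH t h
  have hC := isPatch_rect hcH (t * k) h
  have hBball : rect b t h ⊆ Metric.ball b rb := rect_subset_ball b htb hhrb
  have hCball : rect c (t * k) h ⊆ Metric.ball c rc := rect_subset_ball c htc hhrc
  have hBvol := measureReal_rect b ht0.le hh0.le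
  have hCvol := measureReal_rect c (mul_pos ht0 hk0).le hh0.le
  have himp : ∫ y in rect c (t * k) h, y.2 = ∫ y in rect b t h, y.2 := by
    rw [impulse_rect c (mul_pos ht0 hk0).le hh0.le, impulse_rect b ht0.le hh0.le, ← hkmul]
    ring
  set B := rect b t h
  set C := rect c (t * k) h
  have hBA : B ⊆ A := by
    intro y hy
    have := hbball y (hBball hy)
    rw [hAeq]
    exact ⟨this.1, this.2.2.2.1⟩
  have hAC : Disjoint A C := by
    rw [Set.disjoint_left]
    intro y hyA hyC
    rw [hAeq] at hyA
    exact (hcball y (hCball hyC)).2.2.2.not_gt hyA.2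
  have hD : IsPatch (A \ B) := hA.mono (hA.measurableSet.diff hB.measurableSet) sdiff_subset
  have hDC : Disjoint (A \ B) C := hAC.mono_left sdiff_subset
  have hle := hmax ((A \ B) ∪ C) (hD.union hC) (by
    rw [setIntegral_union hDC hC.measurableSet hD.integrable hC.integrable, himp,
      ← setIntegral_union disjoint_sdiff_left hB.measurableSet hD.integrable hB.integrable,
      sdiff_union_of_subset hBA]) (by
    have h1 := measureReal_union_le (μ := volume) (A \ B) C
    have h2 := measureReal_mono (μ := volume) (sdiff_subset : A \ B ⊆ A) hA.finite
    linarith)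
  have hex := hA.interaction_exchange hB hC hBA hAC
  have hest := hA.exchange_estimate hB hC (W := W) (γ := γ) (ε := 2 * ε) (K := K) himp
    (fun y hy => (hbball y (hBball hy)).2.2.2.2.le)
    (fun y hy => (hcball y (hCball hy)).2.2.1.le)
    (fun x hx y hy => by
      obtain ⟨hxH, hxp, -, -⟩ := hcball x (hCball hx)
      obtain ⟨hyH, hyq, hyb, -, -⟩ := hbball y (hBball hy)
      have hx0 : 0 < x.2 := hxH
      have hy0 : 0 < y.2 := hyH
      have hqp : 0 < q - p := by linarith
      have hdist : q - p ≤ ‖y - x‖ := by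
        refine le_trans ?_ (norm_snd_le (y - x))
        rw [Prod.snd_sub, Real.norm_eq_abs]
        exact le_trans (by linarith) (le_abs_self _)
      refine (G_le hxH hyH).trans ?_
      rw [hK]
      gcongr)
    (by linarith)
  rw [hBvol, hCvol] at hest
  have hth : 0 < t * h := mul_pos ht0 hh0
  have : t * h * ((γ - 2 * ε) * k - (γ + 2 * ε)) ≤ t * h * (t * (K * k * h)) := by linarith
  exact absurd htK (not_lt.2 (le_of_mul_le_mul_left this hth))

end IsPatch

/-- if a maximizer `ω ∈ S_M` does not saturate the mass bound, then its
flux constant vanishes. -/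
theorem mass_deficit_implies_zero_flux (M : ℝ) (hM : 0 < M)
    (ω : ℝ × ℝ → ℝ) (hω : memS M ω) (W γ : ℝ) (hW : 0 < W) (hγ : 0 ≤ γ)
    (hrep : ∀ᵐ x ∂volume.restrict H,
      ω x = Set.indicator {y ∈ H | 0 < Gpot ω y - W * y.2 - γ} (fun _ => (1 : ℝ)) x)
    (hmass : norm1 ω < 1) :
    γ = 0 := by
  obtain ⟨⟨-, A₀, hA₀H, hA₀m, hωA₀, himp₀, hvol₀⟩, hmax⟩ := hω
  have hA₀ : IsPatch A₀ := by
    refine ⟨hA₀m, hA₀H, ne_top_of_le_ne_top ENNReal.one_ne_top hvol₀, ?_⟩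
    by_contra hint
    rw [integral_undef hint] at himp₀
    exact hM.ne himp₀
  rw [Gpot_eq_patchPot hA₀m hA₀H hωA₀] at hrep
  set A : Set (ℝ × ℝ) := {y ∈ H | 0 < patchPot A₀ y - W * y.2 - γ} with hAdef
  have hAH : A ⊆ H := fun y hy => hy.1
  have hAm : MeasurableSet A := by
    have hψ : ContinuousOn (fun y => patchPot A₀ y - W * y.2 - γ) H :=
      (hA₀.continuousOn_patchPot.sub (by fun_prop)).sub continuousOn_const
    exact (hψ.isOpen_inter_preimage isOpen_H isOpen_Ioi).measurableSet
  have hAA₀ : A₀ =ᵐ[volume] A := by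
    rw [ae_restrict_iff' measurableSet_H] at hrep hωA₀
    filter_upwards [hrep, hωA₀] with y h1 h2
    refine propext ?_
    change y ∈ A₀ ↔ y ∈ A
    by_cases hy : y ∈ H
    · have := (h2 hy).symm.trans (h1 hy)
      by_cases h3 : y ∈ A₀ <;> by_cases h4 : y ∈ A <;> simp [h3, h4] at this ⊢
    · exact ⟨fun h => absurd (hA₀H h) hy, fun h => absurd (hAH h) hy⟩
  have hA : IsPatch A := hA₀.congr hAm hAH hAA₀
  have hpot : patchPot A₀ = patchPot A := by
    ext x
    exact setIntegral_congr_set hAA₀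
  have himp : ∫ y in A, y.2 = M := by rw [← himp₀, setIntegral_congr_set hAA₀]
  refine hA.flux_eq_zero_of_isMaximal hW hγ (by rw [← hpot]) ?_
    (by rwa [← norm1_eq_measureReal hAm hAH hrep]) fun A' hA' himp' hvol' => ?_
  · rw [nonempty_iff_ne_empty]
    intro h
    rw [h] at himp
    simp at himp
    exact hM.ne himp
  · have hind : Integrable (A'.indicator fun _ => (1 : ℝ)) (volume.restrict H) :=
      ((integrable_indicator_iff hA'.measurableSet).2 (integrableOn_const hA'.finite)).restrict
    have := hmax (A'.indicator fun _ => (1 : ℝ))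
      ⟨hind, A', hA'.subset, hA'.measurableSet, Eventually.of_forall fun _ => rfl,
        himp'.trans himp, by
          rw [← ENNReal.ofReal_one, ← ofReal_measureReal hA'.finite]
          exact ENNReal.ofReal_le_ofReal hvol'⟩
    rw [energy_eq_interaction hAm hAH hrep, energy_eq_interaction hA'.measurableSet hA'.subset
      (Eventually.of_forall fun _ => rfl)] at this
    linarith
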